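/- Let k ≥ 1 and let p be the odd trigonometric polynomial of degree ≤ k−1 interpolating the sawtooth J₁ at the points {jπ/k : j ∈ ℤ} ∩ S¹ (i.e. at A ∪ (−A) ∪ {0,π} with A = {jπ/k : j = 1,…,k−1}). Then ‖J₁ − p‖_{L¹} = π/(2k), and p is an L¹-best approximation to J₁ among trigonometric polynomials of degree ≤ k−1. -/

import Mathlib

open Real MeasureTheory intervalIntegral

/-- The 2π-periodic sawtooth: `J₁(x) = x` for `x ∈ (−π, π)` and `J₁(π) = 0`. -/
noncomputable def J1fun (x : ℝ) : ℝ :=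
  if x - 2 * π * round (x / (2 * π)) = -π then 0 else x - 2 * π * round (x / (2 * π))

/-- An odd real trigonometric polynomial of degree at most `n`. -/
def IsOddTrigPoly (n : ℕ) (p : ℝ → ℝ) : Prop :=
  ∃ b : ℕ → ℝ, ∀ x : ℝ, p x = ∑ j ∈ Finset.range (n + 1), b j * Real.sin (j * x)

/-- A real trigonometric polynomial of degree at most `n`. -/
def IsTrigPoly (n : ℕ) (p : ℝ → ℝ) : Prop :=
  ∃ a b : ℕ → ℝ, ∀ x : ℝ,
    p x = ∑ j ∈ Finset.range (n + 1), (a j * Real.cos (j * x) + b j * Real.sin (j * x))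

open Polynomial in
/-- A polynomial of degree at most `k` vanishing at `k` distinct points is a multiple of their
nodal polynomial. -/
lemma eq_C_coeff_mul_nodal {P : ℝ[X]} {k : ℕ} {y : ℕ → ℝ} (hP : P.natDegree ≤ k)
    (hy : Set.InjOn y (Finset.range k)) (h0 : ∀ i < k, P.eval (y i) = 0) :
    P = C (P.coeff k) * Lagrange.nodal (Finset.range k) y := by
  have hdeg : (Lagrange.nodal (Finset.range k) y).natDegree = k := by
    simp [Lagrange.natDegree_nodal]
  have hcoeff : (Lagrange.nodal (Finset.range k) y).coeff k = 1 := by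
    have := (Lagrange.nodal_monic (s := Finset.range k) (v := y)).coeff_natDegree
    rwa [hdeg] at this
  refine Polynomial.eq_of_degree_sub_lt_of_eval_index_eq (Finset.range k) hy ?_ ?_
  · rw [Finset.card_range, Polynomial.degree_lt_iff_coeff_zero]
    intro m hm
    rcases hm.eq_or_lt with rfl | hm
    · simp [hcoeff]
    · rw [coeff_sub, coeff_C_mul, coeff_eq_zero_of_natDegree_lt (hP.trans_lt hm),
        coeff_eq_zero_of_natDegree_lt (hdeg.trans_lt hm)]
      simp
  · intro i hi
    rw [h0 i (Finset.mem_range.1 hi), eval_mul, Lagrange.eval_nodal_at_node hi, mul_zero]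

open Polynomial in
/-- The derivative of `t - ∑ b j sin (j t) - c sin (k t)` is a polynomial in `cos t` of degree at
most `k`, whose coefficient of degree `k` is explicit. -/
lemma exists_polynomial_eval_cos {k : ℕ} (hk : 1 ≤ k) (b : ℕ → ℝ) (c : ℝ) :
    ∃ P : ℝ[X], P.natDegree ≤ k ∧ P.coeff k = -(c * k * 2 ^ (k - 1)) ∧
      ∀ t : ℝ, HasDerivAt
        (fun t ↦ t - ∑ j ∈ Finset.range k, b j * Real.sin (j * t) - c * Real.sin (k * t))
        (P.eval (Real.cos t)) t := by
  refine ⟨1 - ∑ j ∈ Finset.range k, C (b j * j) * Chebyshev.T ℝ j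
    - C (c * k) * Chebyshev.T ℝ k, ?_, ?_, fun t ↦ ?_⟩
  · refine (natDegree_sub_le _ _).trans
      (max_le ((natDegree_sub_le _ _).trans (max_le ?_ ?_)) ?_)
    · rw [natDegree_one]
      exact k.zero_le
    · refine natDegree_sum_le_of_forall_le _ _ fun j hj ↦ ?_
      refine (natDegree_C_mul_le _ _).trans ?_
      simpa using (Finset.mem_range.1 hj).le
    · exact (natDegree_C_mul_le _ _).trans (Chebyshev.natDegree_T ℝ k).le
  · have hT : (Chebyshev.T ℝ (k : ℤ)).coeff k = 2 ^ (k - 1) := by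
      simpa [leadingCoeff] using Chebyshev.leadingCoeff_T ℝ (k : ℤ)
    have hsum : (∑ j ∈ Finset.range k, C (b j * j) * Chebyshev.T ℝ (j : ℤ)).coeff k = 0 := by
      rw [finsetSum_coeff]
      refine Finset.sum_eq_zero fun j hj ↦ ?_
      rw [coeff_C_mul, coeff_eq_zero_of_natDegree_lt (by simpa using hj), mul_zero]
    rw [coeff_sub, coeff_sub, hsum, coeff_C_mul, hT, coeff_one, if_neg (by lia)]
    ring
  · have hsin (m a : ℝ) :
        HasDerivAt (fun t ↦ a * Real.sin (m * t)) (a * m * Real.cos (m * t)) t :=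
      ((((hasDerivAt_id' t).const_mul m).sin).const_mul a).congr_deriv (by ring)
    refine (((hasDerivAt_id' t).fun_sub
      (HasDerivAt.fun_sum (u := Finset.range k) fun j _ ↦ hsin j (b j))).fun_sub
        (hsin k c)).congr_deriv ?_
    simp [eval_finsetSum, Chebyshev.T_real_cos]

/-- If `t - ∑ b j sin (j t) - c sin (k t)` has `k + 1` zeros in `[0, π)`, then the sign of `c` is
`(-1) ^ (k + 1)`. -/
lemma neg_one_pow_mul_pos_of_zeros {k : ℕ} (hk : 1 ≤ k) (b : ℕ → ℝ) (c : ℝ) (S : Finset ℝ)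
    (hS : S.card = k + 1) (hmem : ∀ x ∈ S, x ∈ Set.Ico 0 π)
    (hzero : ∀ x ∈ S,
      x - ∑ j ∈ Finset.range k, b j * Real.sin (j * x) - c * Real.sin (k * x) = 0) :
    0 < (-1) ^ (k + 1) * c := by
  obtain ⟨P, hPdeg, hPcoeff, hP⟩ := exists_polynomial_eval_cos hk b c
  set g : ℝ → ℝ := fun t ↦
    t - ∑ j ∈ Finset.range k, b j * Real.sin (j * t) - c * Real.sin (k * t) with hg
  have hgc : Continuous g := by fun_prop
  have hgπ : g π = π := by simp [hg, Real.sin_nat_mul_pi]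
  let z : ℕ → ℝ := fun i ↦ if h : i < k + 1 then S.orderEmbOfFin hS ⟨i, h⟩ else π + i
  have hzS (i : ℕ) (hi : i ≤ k) : z i ∈ S := by
    simp only [z, dif_pos (Nat.lt_succ_of_le hi)]
    exact S.orderEmbOfFin_mem hS _
  have hzmono : StrictMono z := by
    refine strictMono_nat_of_lt_succ fun i ↦ ?_
    rcases lt_trichotomy i k with hi | rfl | hi
    · simp only [z, dif_pos (show i < k + 1 by lia), dif_pos (show i + 1 < k + 1 by lia)]
      exact (S.orderEmbOfFin hS).strictMono (by simp [Fin.lt_def])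
    · have h1 := (hmem _ (hzS i le_rfl)).2
      have h2 : z (i + 1) = π + (i + 1 : ℕ) := by simp [z]
      rw [h2]
      have : (0 : ℝ) ≤ (i + 1 : ℕ) := by positivity
      linarith
    · simp only [z, dif_neg (show ¬ i < k + 1 by lia), dif_neg (show ¬ i + 1 < k + 1 by lia)]
      push_cast
      linarith
  have hrolle (i : ℕ) (hi : i < k) :
      ∃ ξ ∈ Set.Ioo (z i) (z (i + 1)), P.eval (Real.cos ξ) = 0 :=
    exists_hasDerivAt_eq_zero (hzmono i.lt_succ_self) hgc.continuousOn
      ((hzero _ (hzS i hi.le)).trans (hzero _ (hzS (i + 1) hi)).symm) fun x _ ↦ hP x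
  choose! ξ hξ hξ0 using hrolle
  have hzk := hmem _ (hzS k le_rfl)
  obtain ⟨η, hη, hη'⟩ := exists_hasDerivAt_eq_slope g _ hzk.2 hgc.continuousOn fun x _ ↦ hP x
  have hηpos : 0 < P.eval (Real.cos η) := by
    rw [hη', hgπ, show g (z k) = 0 from hzero _ (hzS k le_rfl), sub_zero]
    exact div_pos Real.pi_pos (sub_pos.2 hzk.2)
  have hξnonneg (i : ℕ) (hi : i < k) : 0 ≤ ξ i :=
    (hmem _ (hzS i hi.le)).1.trans (hξ i hi).1.le
  have hξη (i : ℕ) (hi : i < k) : ξ i < η :=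
    (hξ i hi).2.trans ((hzmono.monotone (show i + 1 ≤ k from hi)).trans_lt hη.1)
  have hξlt (i j : ℕ) (hij : i < j) (hj : j < k) : ξ i < ξ j :=
    (hξ i (hij.trans hj)).2.trans
      ((hzmono.monotone (show i + 1 ≤ j from hij)).trans_lt (hξ j hj).1)
  have hinj : Set.InjOn (fun i ↦ Real.cos (ξ i)) (Finset.range k) := by
    intro i hi j hj hij
    simp only [Finset.coe_range, Set.mem_Iio] at hi hj
    have heq : ξ i = ξ j := Real.injOn_cos
      ⟨hξnonneg i hi, ((hξη i hi).trans hη.2).le⟩ ⟨hξnonneg j hj, ((hξη j hj).trans hη.2).le⟩ hij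
    rcases lt_trichotomy i j with h | h | h
    · exact absurd heq (hξlt i j h hj).ne
    · exact h
    · exact absurd heq (hξlt j i h hi).ne'
  have hfac := eq_C_coeff_mul_nodal hPdeg hinj hξ0
  have hprod : 0 < ∏ i ∈ Finset.range k, (Real.cos (ξ i) - Real.cos η) := by
    refine Finset.prod_pos fun i hi ↦ sub_pos.2 ?_
    have hi := Finset.mem_range.1 hi
    exact Real.cos_lt_cos_of_nonneg_of_le_pi (hξnonneg i hi) hη.2.le (hξη i hi)
  have hneg : ∏ i ∈ Finset.range k, (Real.cos η - Real.cos (ξ i))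
      = (-1) ^ k * ∏ i ∈ Finset.range k, (Real.cos (ξ i) - Real.cos η) := by
    have h : ∏ i ∈ Finset.range k, (-1 : ℝ) = (-1) ^ k := by simp
    rw [← h, ← Finset.prod_mul_distrib]
    exact Finset.prod_congr rfl fun i _ ↦ by ring
  rw [hfac, Polynomial.eval_mul, Polynomial.eval_C, Lagrange.eval_nodal, hneg, hPcoeff] at hηpos
  have hk' : (0 : ℝ) < k := by exact_mod_cast hk
  have hpos : 0 < (k * 2 ^ (k - 1)) * ∏ i ∈ Finset.range k, (Real.cos (ξ i) - Real.cos η) := by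
    positivity
  refine pos_of_mul_pos_left (b := (k * 2 ^ (k - 1)) *
    ∏ i ∈ Finset.range k, (Real.cos (ξ i) - Real.cos η)) ?_ hpos.le
  calc _ < _ := hηpos
    _ = _ := by ring

/-- The error of interpolating `x` at the points `jπ/k` has the sign of `(-1) ^ (k + 1) sin (k x)`
on `(-π, π)`. -/
lemma interpolation_error_mul_sin_nonneg {k : ℕ} (hk : 1 ≤ k) (b : ℕ → ℝ)
    (hint : ∀ i < k, ∑ j ∈ Finset.range k, b j * Real.sin (j * (i * π / k)) = i * π / k)
    {x : ℝ} (hx : x ∈ Set.Ioo (-π) π) :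
    0 ≤ (-1) ^ (k + 1) *
      ((x - ∑ j ∈ Finset.range k, b j * Real.sin (j * x)) * Real.sin (k * x)) := by
  have hk' : (0 : ℝ) < k := by exact_mod_cast hk
  wlog hx0 : 0 ≤ x generalizing x
  · have := this (x := -x) ⟨by linarith [hx.2], by linarith [hx.1]⟩ (by linarith)
    simp only [mul_neg, Real.sin_neg, Finset.sum_neg_distrib] at this
    convert this using 1
    ring
  rcases eq_or_ne (Real.sin (k * x)) 0 with hs | hs
  · simp [hs]
  set f := x - ∑ j ∈ Finset.range k, b j * Real.sin (j * x) with hf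
  have hsin (i : ℕ) : Real.sin (k * (i * π / k)) = 0 := by
    rw [mul_div_cancel₀ _ hk'.ne', Real.sin_nat_mul_pi]
  have hnot : x ∉ (Finset.range k).image fun i : ℕ ↦ (i * π / k : ℝ) := by
    intro h
    obtain ⟨i, -, rfl⟩ := Finset.mem_image.1 h
    exact hs (hsin i)
  have hinj : Function.Injective fun i : ℕ ↦ (i * π / k : ℝ) := by
    intro i j hij
    simpa [div_left_inj' hk'.ne', Real.pi_ne_zero] using hij
  have key := neg_one_pow_mul_pos_of_zeros hk b (f / Real.sin (k * x))
    (insert x ((Finset.range k).image fun i : ℕ ↦ (i * π / k : ℝ)))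
    (by rw [Finset.card_insert_of_notMem hnot, Finset.card_image_of_injective _ hinj,
      Finset.card_range])
    (by
      simp only [Finset.mem_insert, Finset.mem_image, Finset.mem_range]
      rintro _ (rfl | ⟨i, hi, rfl⟩)
      · exact ⟨hx0, hx.2⟩
      · refine ⟨by positivity, ?_⟩
        rw [div_lt_iff₀ hk', mul_comm]
        have : (i : ℝ) < k := by exact_mod_cast hi
        exact mul_lt_mul_of_pos_left this Real.pi_pos)
    (by
      simp only [Finset.mem_insert, Finset.mem_image, Finset.mem_range]
      rintro _ (rfl | ⟨i, hi, rfl⟩)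
      · rw [← hf, div_mul_cancel₀ _ hs, sub_self]
      · rw [hint i hi, hsin i]
        ring)
  have hsq : f * Real.sin (k * x) = f / Real.sin (k * x) * Real.sin (k * x) ^ 2 := by
    field_simp
  rw [hsq, ← mul_assoc]
  positivity

lemma measurable_real_sign : Measurable Real.sign := by
  unfold Real.sign
  exact Measurable.ite measurableSet_Iio measurable_const
    (Measurable.ite measurableSet_Ioi measurable_const measurable_const)

lemma abs_real_sign_le_one (r : ℝ) : |Real.sign r| ≤ 1 := by
  rcases Real.sign_apply_eq r with h | h | h <;> simp [h]

lemma intervalIntegrable_mul_sign_sin (k : ℕ) {q : ℝ → ℝ} (hq : Continuous q) (a b : ℝ) :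
    IntervalIntegrable (fun x ↦ q x * Real.sign (Real.sin (k * x))) volume a b := by
  refine (hq.intervalIntegrable a b).mono_fun ?_ (Filter.Eventually.of_forall fun x ↦ ?_)
  · exact (hq.measurable.mul (measurable_real_sign.comp
      (by fun_prop : Continuous fun x : ℝ ↦ Real.sin (k * x)).measurable)).aestronglyMeasurable
  · simp only [Real.norm_eq_abs, abs_mul]
    exact mul_le_of_le_one_right (abs_nonneg _) (abs_real_sign_le_one _)

/-- `sign (sin (k x))` is orthogonal to the trigonometric monomials of degree less than `k`. -/
lemma integral_cos_sin_mul_sign_sin {k m : ℕ} (hm : m < k) :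
    (∫ x in (-π)..π, Real.cos (m * x) * Real.sign (Real.sin (k * x))) = 0 ∧
    (∫ x in (-π)..π, Real.sin (m * x) * Real.sign (Real.sin (k * x))) = 0 := by
  have hk' : (0 : ℝ) < k := by exact_mod_cast (Nat.zero_le m).trans_lt hm
  set θ : ℝ := m * (π / k) with hθ
  have hshift (q : ℝ → ℝ) (hq : Function.Periodic q (2 * π)) :
      ∫ x in (-π)..π, q x * Real.sign (Real.sin (k * x))
        = -∫ x in (-π)..π, q (x + π / k) * Real.sign (Real.sin (k * x)) := by
    have hper : Function.Periodic (fun x ↦ q x * Real.sign (Real.sin (k * x))) (2 * π) := by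
      intro x
      simp only [hq x, mul_add]
      rw [Real.sin_add_nat_mul_two_pi]
    have h1 := hper.intervalIntegral_add_eq (-π) (-π + π / k)
    rw [show -π + 2 * π = π by ring, show -π + π / k + 2 * π = π + π / k by ring] at h1
    rw [h1, ← intervalIntegral.integral_comp_add_right
      (fun x ↦ q x * Real.sign (Real.sin (k * x))), ← intervalIntegral.integral_neg]
    refine intervalIntegral.integral_congr fun x _ ↦ ?_
    simp only [mul_add, mul_div_cancel₀ π hk'.ne', Real.sin_add_pi, Real.sign_neg, mul_neg]
  have hci := intervalIntegrable_mul_sign_sin k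
    (by fun_prop : Continuous fun x : ℝ ↦ Real.cos (m * x)) (-π) π
  have hsi := intervalIntegrable_mul_sign_sin k
    (by fun_prop : Continuous fun x : ℝ ↦ Real.sin (m * x)) (-π) π
  have hC := hshift (fun x ↦ Real.cos (m * x)) fun x ↦ by
    simp only [mul_add]; rw [Real.cos_add_nat_mul_two_pi]
  have hS := hshift (fun x ↦ Real.sin (m * x)) fun x ↦ by
    simp only [mul_add]; rw [Real.sin_add_nat_mul_two_pi]
  have hC' : ∀ x : ℝ, Real.cos (m * (x + π / k)) * Real.sign (Real.sin (k * x))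
      = Real.cos θ * (Real.cos (m * x) * Real.sign (Real.sin (k * x)))
        - Real.sin θ * (Real.sin (m * x) * Real.sign (Real.sin (k * x))) := fun x ↦ by
    rw [mul_add, Real.cos_add]; ring
  have hS' : ∀ x : ℝ, Real.sin (m * (x + π / k)) * Real.sign (Real.sin (k * x))
      = Real.cos θ * (Real.sin (m * x) * Real.sign (Real.sin (k * x)))
        + Real.sin θ * (Real.cos (m * x) * Real.sign (Real.sin (k * x))) := fun x ↦ by
    rw [mul_add, Real.sin_add]; ring
  simp only [hC'] at hC
  simp only [hS'] at hS
  rw [intervalIntegral.integral_sub (hci.const_mul _) (hsi.const_mul _),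
    intervalIntegral.integral_const_mul, intervalIntegral.integral_const_mul] at hC
  rw [intervalIntegral.integral_add (hsi.const_mul _) (hci.const_mul _),
    intervalIntegral.integral_const_mul, intervalIntegral.integral_const_mul] at hS
  have hcos : 0 < 1 + Real.cos θ := by
    have hθπ : θ < π := by
      have : (m : ℝ) < k := by exact_mod_cast hm
      rw [hθ, ← mul_div_assoc, div_lt_iff₀ hk', mul_comm]
      exact mul_lt_mul_of_pos_left this Real.pi_pos
    have := Real.cos_lt_cos_of_nonneg_of_le_pi (show 0 ≤ θ by positivity) le_rfl hθπ
    rw [Real.cos_pi] at this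
    linarith
  set C := ∫ x in (-π)..π, Real.cos (m * x) * Real.sign (Real.sin (k * x))
  set S := ∫ x in (-π)..π, Real.sin (m * x) * Real.sign (Real.sin (k * x))
  have hpos : (1 + Real.cos θ) ^ 2 + Real.sin θ ^ 2 ≠ 0 := by positivity
  exact ⟨mul_left_cancel₀ hpos (by linear_combination (1 + Real.cos θ) * hC + Real.sin θ * hS),
    mul_left_cancel₀ hpos (by linear_combination (1 + Real.cos θ) * hS - Real.sin θ * hC)⟩

lemma IsTrigPoly.continuous {n : ℕ} {q : ℝ → ℝ} (hq : IsTrigPoly n q) : Continuous q := by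
  obtain ⟨a, b, h⟩ := hq
  rw [funext h]
  fun_prop

lemma IsOddTrigPoly.isTrigPoly {n : ℕ} {p : ℝ → ℝ} (hp : IsOddTrigPoly n p) :
    IsTrigPoly n p := by
  obtain ⟨b, h⟩ := hp
  exact ⟨0, b, by simpa using h⟩

lemma IsTrigPoly.integral_mul_sign_sin {k n : ℕ} (hn : n < k) {q : ℝ → ℝ} (hq : IsTrigPoly n q) :
    ∫ x in (-π)..π, q x * Real.sign (Real.sin (k * x)) = 0 := by
  obtain ⟨a, b, h⟩ := hq
  simp only [h, Finset.sum_mul]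
  rw [intervalIntegral.integral_finsetSum fun j _ ↦ intervalIntegrable_mul_sign_sin k
    (by fun_prop : Continuous fun x : ℝ ↦ a j * Real.cos (j * x) + b j * Real.sin (j * x)) _ _]
  refine Finset.sum_eq_zero fun j hj ↦ ?_
  have hjk : j < k := by
    have := Finset.mem_range.1 hj
    lia
  obtain ⟨hC, hS⟩ := integral_cos_sin_mul_sign_sin hjk
  simp only [add_mul, mul_assoc]
  rw [intervalIntegral.integral_add
    ((intervalIntegrable_mul_sign_sin k (by fun_prop) _ _).const_mul _)
    ((intervalIntegrable_mul_sign_sin k (by fun_prop) _ _).const_mul _),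
    intervalIntegral.integral_const_mul, intervalIntegral.integral_const_mul, hC, hS]
  simp

lemma integral_id_mul_sign_sin_zero_to {k : ℕ} (hk : 1 ≤ k) (n : ℕ) :
    ∫ x in (0 : ℝ)..(n * (π / k)), x * Real.sign (Real.sin (k * x))
      = (-1) ^ (n + 1) * n * (π / k) ^ 2 / 2 := by
  have hk' : (0 : ℝ) < k := by exact_mod_cast hk
  have hkc : (k : ℝ) * (π / k) = π := mul_div_cancel₀ π hk'.ne'
  induction n with
  | zero => simp
  | succ n ih =>
    rw [← intervalIntegral.integral_add_adjacent_intervals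
      (intervalIntegrable_mul_sign_sin k continuous_id' 0 (n * (π / k)))
      (intervalIntegrable_mul_sign_sin k continuous_id' _ _)]
    rw [ih]
    have hle : (n : ℝ) * (π / k) ≤ (n + 1 : ℕ) * (π / k) := by
      push_cast
      gcongr
      linarith
    have hpiece : ∫ x in (n * (π / k))..((n + 1 : ℕ) * (π / k)), x * Real.sign (Real.sin (k * x))
        = ∫ x in (n * (π / k))..((n + 1 : ℕ) * (π / k)), x * (-1) ^ n := by
      refine intervalIntegral.integral_congr_Ioo_of_le hle fun x hx ↦ ?_
      have h1 : n * π < k * x := by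
        have := mul_lt_mul_of_pos_left hx.1 hk'
        rwa [mul_left_comm, hkc] at this
      have h2 : k * x < n * π + π := by
        have := mul_lt_mul_of_pos_left hx.2 hk'
        rw [mul_left_comm, hkc] at this
        push_cast at this
        linarith
      have hpos := Real.sin_pos_of_pos_of_lt_pi (x := k * x - n * π) (by linarith) (by linarith)
      rw [Real.sin_sub_nat_mul_pi] at hpos
      congr 1
      rcases neg_one_pow_eq_or ℝ n with h | h
      · rw [h] at hpos ⊢
        exact Real.sign_of_pos (by linarith)
      · rw [h] at hpos ⊢
        exact Real.sign_of_neg (by linarith)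
    rw [hpiece, intervalIntegral.integral_mul_const, integral_id]
    push_cast
    ring

lemma integral_id_mul_sign_sin {k : ℕ} (hk : 1 ≤ k) :
    ∫ x in (-π)..π, x * Real.sign (Real.sin (k * x)) = (-1) ^ (k + 1) * (π ^ 2 / k) := by
  have hk' : (0 : ℝ) < k := by exact_mod_cast hk
  have hright := integral_id_mul_sign_sin_zero_to hk k
  rw [mul_div_cancel₀ π hk'.ne'] at hright
  have hleft : ∫ x in (-π)..0, x * Real.sign (Real.sin (k * x))
      = ∫ x in (0 : ℝ)..π, x * Real.sign (Real.sin (k * x)) := by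
    have := intervalIntegral.integral_comp_neg (a := 0) (b := π)
      fun x : ℝ ↦ x * Real.sign (Real.sin (k * x))
    rw [neg_zero] at this
    rw [← this]
    refine intervalIntegral.integral_congr fun x _ ↦ ?_
    simp [Real.sign_neg]
  rw [← intervalIntegral.integral_add_adjacent_intervals
    (intervalIntegrable_mul_sign_sin k continuous_id' (-π) 0)
    (intervalIntegrable_mul_sign_sin k continuous_id' 0 π)]
  rw [hleft, hright]
  field_simp
  ring

lemma J1fun_of_mem_Ioo {x : ℝ} (hx : x ∈ Set.Ioo (-π) π) : J1fun x = x := by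
  have hround : round (x / (2 * π)) = 0 := by
    have := Real.pi_pos
    rw [round_eq_zero_iff]
    constructor
    · rw [le_div_iff₀ (by positivity)]
      linarith [hx.1]
    · rw [div_lt_iff₀ (by positivity)]
      linarith [hx.2]
  have := hx.1
  simp [J1fun, hround, this.ne']

lemma integral_abs_J1fun_sub (q : ℝ → ℝ) :
    ∫ x in (-π)..π, |J1fun x - q x| = ∫ x in (-π)..π, |x - q x| :=
  intervalIntegral.integral_congr_Ioo_of_le (by linarith [Real.pi_pos]) fun x hx ↦ by
    simp only [J1fun_of_mem_Ioo hx]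

lemma IsTrigPoly.integral_sub_mul_sign_sin {k n : ℕ} (hn : n < k) {q : ℝ → ℝ}
    (hq : IsTrigPoly n q) :
    ∫ x in (-π)..π, (x - q x) * Real.sign (Real.sin (k * x)) = (-1) ^ (k + 1) * (π ^ 2 / k) := by
  simp only [sub_mul]
  rw [intervalIntegral.integral_sub (intervalIntegrable_mul_sign_sin k continuous_id' _ _)
    (intervalIntegrable_mul_sign_sin k hq.continuous _ _), hq.integral_mul_sign_sin hn]
  simpa using integral_id_mul_sign_sin (k := k) (by lia)

lemma IsTrigPoly.pi_sq_div_le_integral_abs {k n : ℕ} (hn : n < k) {q : ℝ → ℝ}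
    (hq : IsTrigPoly n q) : π ^ 2 / k ≤ ∫ x in (-π)..π, |x - q x| := by
  have hle : -π ≤ π := by linarith [Real.pi_pos]
  have hcont : Continuous fun x ↦ x - q x := continuous_id.sub hq.continuous
  have habs : |∫ x in (-π)..π, (x - q x) * Real.sign (Real.sin (k * x))| = π ^ 2 / k := by
    rw [hq.integral_sub_mul_sign_sin hn, abs_mul, abs_pow]
    simp [abs_of_nonneg (show 0 ≤ π ^ 2 / k by positivity)]
  rw [← habs]
  refine (intervalIntegral.abs_integral_le_integral_abs hle).trans ?_
  refine intervalIntegral.integral_mono_on hle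
    (intervalIntegrable_mul_sign_sin k hcont _ _).abs (hcont.abs.intervalIntegrable _ _)
    fun x _ ↦ ?_
  rw [abs_mul]
  exact mul_le_of_le_one_right (abs_nonneg _) (abs_real_sign_le_one _)

/-- If `(-1) ^ (k + 1) sin (k x)` never has the sign opposite to `x - q x` on `(-π, π)`, the lower
bound of `IsTrigPoly.pi_sq_div_le_integral_abs` is attained. -/
lemma IsTrigPoly.integral_abs_eq {k n : ℕ} (hn : n < k) {q : ℝ → ℝ} (hq : IsTrigPoly n q)
    (hsign : ∀ x ∈ Set.Ioo (-π) π, 0 ≤ (-1) ^ (k + 1) * ((x - q x) * Real.sin (k * x))) :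
    ∫ x in (-π)..π, |x - q x| = π ^ 2 / k := by
  have hk' : (0 : ℝ) < k := by exact_mod_cast (Nat.zero_le n).trans_lt hn
  have hnull : ∀ᵐ x : ℝ, Real.sin (k * x) ≠ 0 := by
    have hcount : {x : ℝ | Real.sin (k * x) = 0}.Countable := by
      refine (Set.countable_range fun m : ℤ ↦ (m * π / k : ℝ)).mono fun x hx ↦ ?_
      obtain ⟨m, hm⟩ := Real.sin_eq_zero_iff.1 hx
      exact ⟨m, by simp only [hm]; field_simp⟩
    filter_upwards [hcount.ae_notMem volume] with x hx using hx
  have heq : ∫ x in (-π)..π, |x - q x|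
      = ∫ x in (-π)..π, (-1) ^ (k + 1) * ((x - q x) * Real.sign (Real.sin (k * x))) := by
    refine intervalIntegral.integral_congr_ae ?_
    filter_upwards [hnull, Measure.ae_ne volume π] with x hx hxπ hmem
    rw [Set.uIoc_of_le (by linarith [Real.pi_pos])] at hmem
    have h := hsign x ⟨hmem.1, lt_of_le_of_ne hmem.2 hxπ⟩
    rw [← mul_assoc] at h ⊢
    set u := (-1) ^ (k + 1) * (x - q x) with hu
    have habs : |x - q x| = |u| := by simp [hu, abs_mul]
    rw [habs]
    rcases hx.lt_or_gt with hs | hs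
    · rw [Real.sign_of_neg hs, abs_of_nonpos (nonpos_of_mul_nonneg_left h hs)]
      ring
    · rw [Real.sign_of_pos hs, abs_of_nonneg (nonneg_of_mul_nonneg_left h hs), mul_one]
  rw [heq, intervalIntegral.integral_const_mul, hq.integral_sub_mul_sign_sin hn, ← mul_assoc,
    ← mul_pow]
  simp

/-- **The equidistant interpolant of the sawtooth is L¹-optimal.**
If `p` is the odd trigonometric polynomial of degree ≤ k−1 interpolating `J₁`
at the points `jπ/k`, `j ∈ ℤ`, then `‖J₁ − p‖_{L¹} = π/(2k)`, and `p` is a best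
L¹ approximation to `J₁` among all trigonometric polynomials of degree ≤ k−1. -/
theorem sawtooth_interpolant_l1_optimal
    (k : ℕ) (hk : 1 ≤ k) (p : ℝ → ℝ)
    (hp : IsOddTrigPoly (k - 1) p)
    (hinterp : ∀ j : ℤ, p ((j : ℝ) * π / k) = J1fun ((j : ℝ) * π / k)) :
    (1 / (2 * π)) * (∫ x in (-π)..π, |J1fun x - p x|) = π / (2 * k) ∧
    ∀ q : ℝ → ℝ, IsTrigPoly (k - 1) q →
      π / (2 * k) ≤ (1 / (2 * π)) * ∫ x in (-π)..π, |J1fun x - q x| := by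
  have hk' : (0 : ℝ) < k := by exact_mod_cast hk
  have hlt : k - 1 < k := by lia
  have hscale : π / (2 * k) = 1 / (2 * π) * (π ^ 2 / k) := by
    field_simp
  rw [hscale]
  refine ⟨?_, fun q hq ↦ ?_⟩
  · obtain ⟨b, hb⟩ := hp
    rw [integral_abs_J1fun_sub, IsTrigPoly.integral_abs_eq hlt (IsOddTrigPoly.isTrigPoly ⟨b, hb⟩)]
    rw [Nat.sub_add_cancel hk] at hb
    intro x hx
    rw [hb x]
    refine interpolation_error_mul_sin_nonneg hk b (fun i hi ↦ ?_) hx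
    have hi' : (i : ℝ) < k := by exact_mod_cast hi
    have hmem : (i * π / k : ℝ) ∈ Set.Ioo (-π) π := by
      refine ⟨(neg_lt_zero.2 Real.pi_pos).trans_le (by positivity), ?_⟩
      rw [div_lt_iff₀ hk', mul_comm]
      exact mul_lt_mul_of_pos_left hi' Real.pi_pos
    have h := hinterp i
    rw [Int.cast_natCast, J1fun_of_mem_Ioo hmem, hb] at h
    exact h
  · rw [integral_abs_J1fun_sub]
    gcongr
    exact hq.pi_sq_div_le_integral_abs hlt
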